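/- arXiv:1911.05167 — 2 statements merged into one kernel-verified Lean document; each statement's English description precedes it below -/
import Mathlib

section
/- In the setting of the augmented Lagrangian L_ρ, suppose F is differentiable with L-Lipschitz gradient (L > 0), G ∈ ℝ^{d×d} is symmetric positive semidefinite with smallest eigenvalue λ_min(G), η > 0, and let σ_A denote the smallest eigenvalue of AᵀA. Suppose x, x⁺, v ∈ ℝ^d, z ∈ ℝ^p and y = (y_1,…,y_m) ∈ (ℝ^l)^m satisfy the x-update optimality condition v + (1/η)G(x⁺ − x) − Aᵀz + ρAᵀ(Ax⁺ + Σ_{j=1}^m B_j y_j − c) = 0. Then L_ρ(x⁺, y, z) − L_ρ(x, y, z) ≤ −(λ_min(G)/η + ρσ_A/2 − L)‖x⁺ − x‖² + (1/(2L))‖v − ∇F(x)‖². -/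
open ContinuousLinearMap
open scoped RealInnerProductSpace

/-- The augmented Lagrangian `L_ρ(x, y, z)`. -/
noncomputable def augLag {d l p m : ℕ}
    (F : EuclideanSpace ℝ (Fin d) → ℝ)
    (g : Fin m → EuclideanSpace ℝ (Fin l) → ℝ)
    (A : EuclideanSpace ℝ (Fin d) →L[ℝ] EuclideanSpace ℝ (Fin p))
    (B : Fin m → EuclideanSpace ℝ (Fin l) →L[ℝ] EuclideanSpace ℝ (Fin p))
    (c : EuclideanSpace ℝ (Fin p)) (ρ : ℝ)
    (x : EuclideanSpace ℝ (Fin d)) (y : Fin m → EuclideanSpace ℝ (Fin l))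
    (z : EuclideanSpace ℝ (Fin p)) : ℝ :=
  F x + ∑ j, g j (y j) - ⟪z, A x + ∑ j, B j (y j) - c⟫ +
    (ρ / 2) * ‖A x + ∑ j, B j (y j) - c‖ ^ 2

theorem LinearMap.IsSymmetric.le_inner_of_forall_hasEigenvalue {E : Type*} [NormedAddCommGroup E]
    [InnerProductSpace ℝ E] [FiniteDimensional ℝ E] {T : E →ₗ[ℝ] E} (hT : T.IsSymmetric) {a : ℝ}
    (ha : ∀ μ, Module.End.HasEigenvalue T μ → a ≤ μ) (x : E) : a * ‖x‖ ^ 2 ≤ ⟪T x, x⟫ := by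
  set b := hT.eigenvectorBasis rfl
  rw [← b.sum_inner_mul_inner (T x) x, ← b.sum_sq_norm_inner_right x, Finset.mul_sum]
  refine Finset.sum_le_sum fun i _ => ?_
  have h : ⟪T x, b i⟫ = hT.eigenvalues rfl i * ⟪b i, x⟫ := by
    rw [hT x (b i), hT.apply_eigenvectorBasis rfl i, real_inner_comm]
    exact real_inner_smul_left _ _ _
  rw [h, Real.norm_eq_abs, sq_abs, mul_assoc, ← sq]
  exact mul_le_mul_of_nonneg_right (ha _ (hT.hasEigenvalue_eigenvalues rfl i)) (sq_nonneg _)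

theorem IsSelfAdjoint.sInf_spectrum_mul_norm_sq_le_inner {E : Type*} [NormedAddCommGroup E]
    [InnerProductSpace ℝ E] [FiniteDimensional ℝ E] [CompleteSpace E] {T : E →L[ℝ] E}
    (hT : IsSelfAdjoint T) (x : E) : sInf (spectrum ℝ T) * ‖x‖ ^ 2 ≤ ⟪T x, x⟫ := by
  refine hT.isSymmetric.le_inner_of_forall_hasEigenvalue (fun μ hμ => ?_) x
  refine csInf_le (spectrum.isCompact T).bddBelow ?_
  obtain ⟨w, hw⟩ := hμ.exists_hasEigenvector
  refine spectrum.mem_iff.2 fun hu => hw.2 ?_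
  obtain ⟨S, hS⟩ := hu.exists_left_inv
  have h := congrArg (fun R : E →L[ℝ] E => R w) hS
  have hTw : T w = μ • w := hw.apply_eq_smul
  simpa [mul_apply_eq_comp, Algebra.algebraMap_eq_smul_one, hTw] using h.symm

/-- The descent lemma for functions with Lipschitz gradient. -/
theorem Differentiable.le_add_inner_gradient_add_sq {E : Type*} [NormedAddCommGroup E]
    [InnerProductSpace ℝ E] [CompleteSpace E] {F : E → ℝ} {L : ℝ} (hF : Differentiable ℝ F)
    (hL : ∀ a b, ‖gradient F a - gradient F b‖ ≤ L * ‖a - b‖) (x h : E) :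
    F (x + h) ≤ F x + ⟪gradient F x, h⟫ + L / 2 * ‖h‖ ^ 2 := by
  have hd : ∀ t : ℝ, HasDerivAt
      (fun t : ℝ => F (x + t • h) - t * ⟪gradient F x, h⟫ - L / 2 * ‖h‖ ^ 2 * t ^ 2)
      (⟪gradient F (x + t • h), h⟫ - ⟪gradient F x, h⟫ - L * ‖h‖ ^ 2 * t) t := by
    intro t
    have hline : HasDerivAt (fun t : ℝ => x + t • h) h t := by
      simpa using ((hasDerivAt_id t).smul_const h).const_add x
    have hcomp := (hF (x + t • h)).hasGradientAt.hasFDerivAt.comp_hasDerivAt t hline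
    rw [InnerProductSpace.toDual_apply_apply] at hcomp
    refine ((hcomp.sub ((hasDerivAt_id t).mul_const ⟪gradient F x, h⟫)).sub
      ((hasDerivAt_pow 2 t).const_mul (L / 2 * ‖h‖ ^ 2))).congr_deriv ?_
    norm_num
    ring
  have hanti := antitoneOn_of_deriv_nonpos (convex_Icc (0 : ℝ) 1)
    (fun t _ => (hd t).continuousAt.continuousWithinAt)
    (fun t _ => (hd t).differentiableAt.differentiableWithinAt) (fun t ht => by
      rw [interior_Icc] at ht
      have hcs := real_inner_le_norm (gradient F (x + t • h) - gradient F x) h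
      have hlip := hL (x + t • h) x
      rw [add_sub_cancel_left, norm_smul, Real.norm_eq_abs, abs_of_pos ht.1] at hlip
      have := mul_le_mul_of_nonneg_right hlip (norm_nonneg h)
      rw [inner_sub_left] at hcs
      rw [(hd t).deriv]
      linarith)
  have := hanti (Set.left_mem_Icc.2 zero_le_one) (Set.right_mem_Icc.2 zero_le_one) zero_le_one
  simp only [zero_smul, one_smul, add_zero] at this
  linarith

/-- Descent of the augmented Lagrangian along the linearized
`x`-update, where `lminG` is the smallest eigenvalue of the symmetric positive
semidefinite matrix `G` and `σA` is the smallest eigenvalue of `AᵀA`. -/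
theorem admm_x_descent {d l p m : ℕ}
    (F : EuclideanSpace ℝ (Fin d) → ℝ)
    (g : Fin m → EuclideanSpace ℝ (Fin l) → ℝ)
    (A : EuclideanSpace ℝ (Fin d) →L[ℝ] EuclideanSpace ℝ (Fin p))
    (B : Fin m → EuclideanSpace ℝ (Fin l) →L[ℝ] EuclideanSpace ℝ (Fin p))
    (c : EuclideanSpace ℝ (Fin p)) (ρ : ℝ) (hρ : 0 < ρ)
    (L : ℝ) (hL : 0 < L)
    (hF : Differentiable ℝ F)
    (hFlip : ∀ a b, ‖gradient F a - gradient F b‖ ≤ L * ‖a - b‖)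
    (G : EuclideanSpace ℝ (Fin d) →L[ℝ] EuclideanSpace ℝ (Fin d))
    (hGsa : IsSelfAdjoint G) (lminG : ℝ)
    (hlminG : lminG = sInf (spectrum ℝ G)) (hGpsd : 0 ≤ lminG)
    (η : ℝ) (hη : 0 < η)
    (σA : ℝ) (hσA : σA = sInf (spectrum ℝ (adjoint A ∘L A)))
    (x xp v : EuclideanSpace ℝ (Fin d)) (z : EuclideanSpace ℝ (Fin p))
    (y : Fin m → EuclideanSpace ℝ (Fin l))
    (hopt : v + η⁻¹ • G (xp - x) - adjoint A z +
        ρ • adjoint A (A xp + ∑ j, B j (y j) - c) = 0) :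
    augLag F g A B c ρ xp y z - augLag F g A B c ρ x y z ≤
      -(lminG / η + ρ * σA / 2 - L) * ‖xp - x‖ ^ 2 +
        (1 / (2 * L)) * ‖v - gradient F x‖ ^ 2 := by
  obtain ⟨h, rfl⟩ : ∃ h, xp = x + h := ⟨xp - x, by abel⟩
  have hdesc := hF.le_add_inner_gradient_add_sq hFlip x h
  have hG := hGsa.sInf_spectrum_mul_norm_sq_le_inner h
  have hA := (IsSelfAdjoint.adjoint_conj
    (IsSelfAdjoint.one (EuclideanSpace ℝ (Fin p) →L[ℝ] EuclideanSpace ℝ (Fin p))) A)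
  have hA := IsSelfAdjoint.sInf_spectrum_mul_norm_sq_le_inner (T := adjoint A ∘L A) hA h
  rw [← hlminG] at hG
  rw [← hσA, ContinuousLinearMap.comp_apply, adjoint_inner_left, real_inner_self_eq_norm_sq] at hA
  rw [add_sub_cancel_left] at hopt ⊢
  set r := A x + ∑ j, B j (y j) - c with hr
  have hrp : A (x + h) + ∑ j, B j (y j) - c = r + A h := by rw [map_add, hr]; abel
  have hinner := congrArg (fun w => ⟪w, h⟫) hopt
  simp only [hrp, inner_add_left, inner_sub_left, real_inner_smul_left, adjoint_inner_left,
    inner_zero_left, real_inner_self_eq_norm_sq] at hinner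
  simp only [augLag, hrp, ← hr, norm_add_sq_real, inner_add_right]
  have hyoung : ⟪gradient F x - v, h⟫ ≤ 1 / (2 * L) * ‖v - gradient F x‖ ^ 2 + L / 2 * ‖h‖ ^ 2 := by
    have hcs := real_inner_le_norm (gradient F x - v) h
    rw [norm_sub_rev] at hcs
    have hsq : 1 / (2 * L) * ‖v - gradient F x‖ ^ 2 + L / 2 * ‖h‖ ^ 2
        - ‖v - gradient F x‖ * ‖h‖ = 1 / (2 * L) * (‖v - gradient F x‖ - L * ‖h‖) ^ 2 := by
      field_simp
      ring
    have : 0 ≤ 1 / (2 * L) * (‖v - gradient F x‖ - L * ‖h‖) ^ 2 := by positivity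
    linarith
  rw [inner_sub_left] at hyoung
  have hG' := mul_le_mul_of_nonneg_left hG (inv_pos.2 hη).le
  have hA' := mul_le_mul_of_nonneg_left hA hρ.le
  rw [div_eq_inv_mul lminG η]
  linarith
end

section
/- Let A ∈ ℝ^{p×d} with AAᵀ positive definite with smallest eigenvalue λ > 0, B_1, …, B_m ∈ ℝ^{p×l}, c ∈ ℝ^p, G ∈ ℝ^{d×d}, η > 0, ρ > 0, and let F : ℝ^d → ℝ be differentiable with L-Lipschitz gradient. Suppose x⁻, x, x⁺, v, v' ∈ ℝ^d, z, z⁺ ∈ ℝ^p and blocks y⁺_1, …, y⁺_m ∈ ℝ^l satisfy z⁺ = z − ρ(Ax⁺ + Σ_{j=1}^m B_j y⁺_j − c), Aᵀz⁺ = v + (1/η)G(x⁺ − x), Aᵀz = v' + (1/η)G(x − x⁻), ‖v − ∇F(x)‖² ≤ C, and ‖v' − ∇F(x⁻)‖² ≤ C. Then the feasibility residual satisfies ‖Ax⁺ + Σ_{j=1}^m B_j y⁺_j − c‖² ≤ (1/ρ²)[18C/λ + (3‖G‖²/(λη²))‖x⁺ − x‖² + (9L²/λ + 3‖G‖²/(λη²))‖x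 − x⁻‖²]. -/
open ContinuousLinearMap

/-- The smallest spectral value of `A Aᵀ` is a lower bound for its quadratic form. -/
lemma sInf_spectrum_mul_norm_sq_le_norm_adjoint_sq {E H : Type*}
    [NormedAddCommGroup E] [InnerProductSpace ℝ E] [CompleteSpace E]
    [NormedAddCommGroup H] [InnerProductSpace ℝ H] [FiniteDimensional ℝ H] [CompleteSpace H]
    (A : E →L[ℝ] H) (w : H) :
    sInf (spectrum ℝ (A ∘L adjoint A)) * ‖w‖ ^ 2 ≤ ‖adjoint A w‖ ^ 2 := by
  rcases eq_or_ne w 0 with rfl | hw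
  · simp
  have : Nontrivial H := ⟨w, 0, hw⟩
  have hquad : ∀ u : H, inner ℝ ((A ∘L adjoint A) u) u = ‖adjoint A u‖ ^ 2 := fun u => by
    rw [ContinuousLinearMap.comp_apply, ← adjoint_inner_right, real_inner_self_eq_norm_sq]
  have hsymm : ((A ∘L adjoint A : H →L[ℝ] H) : H →ₗ[ℝ] H).IsSymmetric := fun u u' => by
    change inner ℝ (A (adjoint A u)) u' = inner ℝ u (A (adjoint A u'))
    rw [← adjoint_inner_right, adjoint_inner_left]
  have hmem := hsymm.hasEigenvalue_iInf_of_finiteDimensional.mem_spectrum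
  rw [← ContinuousLinearMap.spectrum_eq] at hmem
  have hle := csInf_le (spectrum.isCompact (𝕜 := ℝ) (A ∘L adjoint A)).bddBelow hmem
  have hinf := hle.trans (ciInf_le ⟨0, by
    rintro _ ⟨u, rfl⟩
    have := hquad u
    simp only [ContinuousLinearMap.coe_coe, this, RCLike.re_to_real]
    positivity⟩ (⟨w, hw⟩ : {u : H // u ≠ 0}))
  have hw' : 0 < ‖w‖ ^ 2 := by positivity
  have := hquad w
  simp only [ContinuousLinearMap.coe_coe, this, RCLike.re_to_real] at hinf
  exact (le_div_iff₀ hw').1 hinf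

/-- The squared norm of a sum of three vectors is at most three times the sum of the squares. -/
lemma norm_add₃_sq_le {E : Type*} [SeminormedAddCommGroup E] (a b c : E) :
    ‖a + b + c‖ ^ 2 ≤ 3 * (‖a‖ ^ 2 + ‖b‖ ^ 2 + ‖c‖ ^ 2) := by
  have h := pow_le_pow_left₀ (norm_nonneg _) (norm_add₃_le (a := a) (b := b) (c := c)) 2
  nlinarith [sq_nonneg (‖a‖ - ‖b‖), sq_nonneg (‖b‖ - ‖c‖), sq_nonneg (‖a‖ - ‖c‖)]

/-- Bound on the feasibility residual of the ADMM iterate,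
obtained from the dual update and the dual-variable bound; `lam` is the smallest
eigenvalue of the positive definite matrix `A Aᵀ`. -/
theorem admm_feasibility_residual_bound {d l p m : ℕ}
    (A : EuclideanSpace ℝ (Fin d) →L[ℝ] EuclideanSpace ℝ (Fin p))
    (lam : ℝ) (hlam_pos : 0 < lam)
    (hlam : lam = sInf (spectrum ℝ (A ∘L adjoint A)))
    (B : Fin m → EuclideanSpace ℝ (Fin l) →L[ℝ] EuclideanSpace ℝ (Fin p))
    (c : EuclideanSpace ℝ (Fin p))
    (G : EuclideanSpace ℝ (Fin d) →L[ℝ] EuclideanSpace ℝ (Fin d))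
    (η ρ : ℝ) (hη : 0 < η) (hρ : 0 < ρ)
    (F : EuclideanSpace ℝ (Fin d) → ℝ) (L C : ℝ)
    (hF : Differentiable ℝ F)
    (hFlip : ∀ a b, ‖gradient F a - gradient F b‖ ≤ L * ‖a - b‖)
    (xm x xp v v' : EuclideanSpace ℝ (Fin d))
    (z zp : EuclideanSpace ℝ (Fin p))
    (yp : Fin m → EuclideanSpace ℝ (Fin l))
    (hdual : zp = z - ρ • (A xp + ∑ j, B j (yp j) - c))
    (hzp : adjoint A zp = v + η⁻¹ • G (xp - x))
    (hz : adjoint A z = v' + η⁻¹ • G (x - xm))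
    (hv : ‖v - gradient F x‖ ^ 2 ≤ C)
    (hv' : ‖v' - gradient F xm‖ ^ 2 ≤ C) :
    ‖A xp + ∑ j, B j (yp j) - c‖ ^ 2 ≤
      (1 / ρ ^ 2) * (18 * C / lam + (3 * ‖G‖ ^ 2 / (lam * η ^ 2)) * ‖xp - x‖ ^ 2
        + (9 * L ^ 2 / lam + 3 * ‖G‖ ^ 2 / (lam * η ^ 2)) * ‖x - xm‖ ^ 2) := by
  set r := A xp + ∑ j, B j (yp j) - c
  have hlow := sInf_spectrum_mul_norm_sq_le_norm_adjoint_sq A (zp - z)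
  rw [← hlam] at hlow
  have hnorm : ‖zp - z‖ ^ 2 = ρ ^ 2 * ‖r‖ ^ 2 := by
    rw [hdual, sub_sub_cancel_left, norm_neg, norm_smul, mul_pow, Real.norm_eq_abs, sq_abs]
  have hsplit : adjoint A (zp - z)
      = (v - v') + η⁻¹ • G (xp - x) + -(η⁻¹ • G (x - xm)) := by
    rw [map_sub, hzp, hz]
    abel
  have hvsplit : v - v' = (v - gradient F x) + (gradient F x - gradient F xm)
      + -(v' - gradient F xm) := by
    abel
  have hG : ∀ u, ‖η⁻¹ • G u‖ ^ 2 ≤ ‖G‖ ^ 2 / η ^ 2 * ‖u‖ ^ 2 := fun u => by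
    rw [norm_smul, mul_pow, Real.norm_eq_abs, sq_abs]
    calc η⁻¹ ^ 2 * ‖G u‖ ^ 2 ≤ η⁻¹ ^ 2 * (‖G‖ * ‖u‖) ^ 2 := by
          gcongr
          exact G.le_opNorm u
      _ = ‖G‖ ^ 2 / η ^ 2 * ‖u‖ ^ 2 := by
          field_simp
  have hgrad : ‖gradient F x - gradient F xm‖ ^ 2 ≤ L ^ 2 * ‖x - xm‖ ^ 2 := by
    rw [← mul_pow]
    exact pow_le_pow_left₀ (norm_nonneg _) (hFlip x xm) 2
  have hvv := norm_add₃_sq_le (v - gradient F x) (gradient F x - gradient F xm)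
    (-(v' - gradient F xm))
  rw [← hvsplit, norm_neg] at hvv
  have hsum := norm_add₃_sq_le (v - v') (η⁻¹ • G (xp - x)) (-(η⁻¹ • G (x - xm)))
  rw [← hsplit, norm_neg] at hsum
  have hmain : lam * (ρ ^ 2 * ‖r‖ ^ 2) ≤ 18 * C + 3 * (‖G‖ ^ 2 / η ^ 2 * ‖xp - x‖ ^ 2)
      + (9 * (L ^ 2 * ‖x - xm‖ ^ 2) + 3 * (‖G‖ ^ 2 / η ^ 2 * ‖x - xm‖ ^ 2)) := by
    rw [← hnorm]
    linarith [hG (xp - x), hG (x - xm)]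
  calc ‖r‖ ^ 2 = lam * (ρ ^ 2 * ‖r‖ ^ 2) / (lam * ρ ^ 2) := by
        field_simp
    _ ≤ _ := div_le_div_of_nonneg_right hmain (by positivity)
    _ = _ := by
        field_simp
end
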